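/- arXiv:1406.3776 — 2 statements merged into one kernel-verified Lean document; each statement's English description precedes it below -/
import Mathlib

section
/- Assume additionally that q^n ≠ −1 for every n ∈ ℤ. The bilinear map ϕ: 𝔄_q × 𝔄_q → ℂ defined on basis elements by ϕ(L_n, L_m) = δ_{n+m,0}·q^{−n}{n+1}{n}{n−1}/(6(1+q^n)) and ϕ = 0 on all other pairs of basis elements satisfies the 2-cocycle identity −ϕ([x₀,x₁]_q, α_q(x₂)) + (−1)^{|x₁||x₂|} ϕ([x₀,x₂]_q, α_q(x₁)) + ϕ(α_q(x₀), [x₁,x₂]_q) = 0 for all homogeneous x₀, x₁, x₂ ∈ 𝔄_q. -/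
open Finsupp

/-- Index type for the basis of the q-deformed Heisenberg-Virasoro superalgebra:
`L m, I m` (even), `G m, T m` (odd), for `m ∈ ℤ`. -/
inductive BIdx : Type
  | L : ℤ → BIdx
  | I : ℤ → BIdx
  | G : ℤ → BIdx
  | T : ℤ → BIdx
  deriving DecidableEq

/-- The underlying super vector space `𝔄_q`: the free `ℂ`-module on the basis `BIdx`. -/
abbrev Aq : Type := BIdx →₀ ℂ

/-- Parity of the basis elements: `L, I` even (`false`), `G, T` odd (`true`). -/
def BIdx.parity : BIdx → Bool
  | .L _ => false
  | .I _ => false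
  | .G _ => true
  | .T _ => true

/-- The `q`-number `{n} = (1 - qⁿ)/(1 - q)`. -/
noncomputable def qnum (q : ℂ) (n : ℤ) : ℂ := (1 - q ^ n) / (1 - q)

/-- The bracket `[·,·]_q` on basis elements (extended by super-skew-symmetry). -/
noncomputable def bk (q : ℂ) : BIdx → BIdx → Aq
  | .L m, .L n => single (.L (m + n)) (qnum q m - qnum q n)
  | .L m, .I n => single (.I (m + n)) (-(qnum q n))
  | .I m, .L n => single (.I (m + n)) (qnum q m)
  | .L m, .G n => single (.G (m + n)) (qnum q m - qnum q (n + 1))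
  | .G m, .L n => single (.G (m + n)) (qnum q (m + 1) - qnum q n)
  | .I m, .G n => single (.T (m + n)) (qnum q m)
  | .G m, .I n => single (.T (m + n)) (-(qnum q n))
  | .L m, .T n => single (.T (m + n)) (-(qnum q (n + 1)))
  | .T m, .L n => single (.T (m + n)) (qnum q (m + 1))
  | _, _ => 0

/-- Bilinear extension of the bracket `[·,·]_q` to all of `𝔄_q`. -/
noncomputable def bkA (q : ℂ) (x y : Aq) : Aq :=
  x.sum fun i a => y.sum fun j b => (a * b) • bk q i j

/-- The eigenvalue of the twist map `α_q` on each basis element. -/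
noncomputable def acoef (q : ℂ) : BIdx → ℂ
  | .L n => 1 + q ^ n
  | .I n => 1 + q ^ n
  | .G n => 1 + q ^ (n + 1)
  | .T n => 1 + q ^ (n + 1)

/-- The even linear twist map `α_q` of `𝔄_q`. -/
noncomputable def alq (q : ℂ) (x : Aq) : Aq :=
  x.sum fun i a => single i (acoef q i * a)

/-- `x` is homogeneous of parity `p`. -/
def homOf (p : Bool) (x : Aq) : Prop := ∀ i ∈ x.support, BIdx.parity i = p

/-- The sign `(−1)^{|x||y|}` for parities `a`, `b`. -/
noncomputable def sgn (a b : Bool) : ℂ := if a && b then -1 else 1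

/-- Evaluation of the bilinear form with basis coefficients `c` on elements of `𝔄_q`. -/
noncomputable def cA (c : BIdx → BIdx → ℂ) (x y : Aq) : ℂ :=
  x.sum fun i a => y.sum fun j b => a * b * c i j

/-- `c` is even: it vanishes on pairs of basis elements of opposite parity. -/
def IsEvenBilinear (c : BIdx → BIdx → ℂ) : Prop :=
  ∀ i j : BIdx, BIdx.parity i ≠ BIdx.parity j → c i j = 0

/-- The 2-cocycle identity (with trivial coefficients) for the bilinear form `c`,
stated for all homogeneous `x₀, x₁, x₂ ∈ 𝔄_q`. -/
def Cocycle2Identity (q : ℂ) (c : BIdx → BIdx → ℂ) : Prop :=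
  ∀ (p0 p1 p2 : Bool) (x0 x1 x2 : Aq), homOf p0 x0 → homOf p1 x1 → homOf p2 x2 →
    -(cA c (bkA q x0 x1) (alq q x2)) + sgn p1 p2 * cA c (bkA q x0 x2) (alq q x1)
      + cA c (alq q x0) (bkA q x1 x2) = 0

/-- An even bilinear 2-cocycle of `𝔄_q` with trivial coefficients. -/
def IsCocycle (q : ℂ) (c : BIdx → BIdx → ℂ) : Prop :=
  IsEvenBilinear c ∧ Cocycle2Identity q c

/-- Evaluation of the linear form with basis coefficients `f` on an element of `𝔄_q`. -/
noncomputable def fA (f : BIdx → ℂ) (x : Aq) : ℂ := x.sum fun i a => a * f i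

/-- `c` is a 2-coboundary: `c(x,y) = −f([x,y]_q)` for some even linear map `f : 𝔄_q → ℂ`. -/
def IsCoboundary (q : ℂ) (c : BIdx → BIdx → ℂ) : Prop :=
  ∃ f : BIdx → ℂ, (∀ i : BIdx, BIdx.parity i = true → f i = 0) ∧
    ∀ i j : BIdx, c i j = -(fA f (bk q i j))

/-- The 2-cocycle `ϕ`, supported on pairs `(L_n, L_{-n})`. -/
noncomputable def phi1 (q : ℂ) : BIdx → BIdx → ℂ
  | .L n, .L m =>
      if n + m = 0 then
        q ^ (-n) * qnum q (n + 1) * qnum q n * qnum q (n - 1) / (6 * (1 + q ^ n))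
      else 0
  | _, _ => 0

/-- Auxiliary value `φ(L_n, I_m)`. -/
noncomputable def phiLI (q : ℂ) (n m : ℤ) : ℂ :=
  if n + m = 0 then 2 * q ^ (-n) * qnum q (n + 1) * qnum q n / (1 + q ^ n) else 0

/-- The 2-cocycle `φ`, supported on pairs `(L_n, I_m)` and `(I_m, L_n)`. -/
noncomputable def phi2 (q : ℂ) : BIdx → BIdx → ℂ
  | .L n, .I m => phiLI q n m
  | .I m, .L n => -phiLI q n m
  | _, _ => 0

/-- The 2-cocycle `ψ`, supported on pairs `(I_n, I_{-n})`. -/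
noncomputable def phi3 (q : ℂ) : BIdx → BIdx → ℂ
  | .I n, .I m => if n + m = 0 then 2 * q ^ m * qnum q n / (1 + q ^ m) else 0
  | _, _ => 0

theorem cA_add_left (c : BIdx → BIdx → ℂ) (x x' y : Aq) :
    cA c (x + x') y = cA c x y + cA c x' y := by
  unfold cA
  rw [Finsupp.sum_add_index']
  · intro i; simp
  · intro i a b
    rw [← Finsupp.sum_add]
    refine Finsupp.sum_congr fun j _ => ?_
    ring

theorem cA_add_right (c : BIdx → BIdx → ℂ) (x y y' : Aq) :
    cA c x (y + y') = cA c x y + cA c x y' := by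
  unfold cA
  rw [← Finsupp.sum_add]
  refine Finsupp.sum_congr fun i _ => ?_
  rw [Finsupp.sum_add_index']
  · intro i; simp
  · intro j a b; ring

theorem bkA_add_left (q : ℂ) (x x' y : Aq) :
    bkA q (x + x') y = bkA q x y + bkA q x' y := by
  unfold bkA
  rw [Finsupp.sum_add_index']
  · intro i; simp
  · intro i a b
    rw [← Finsupp.sum_add]
    refine Finsupp.sum_congr fun j _ => ?_
    rw [add_mul, add_smul]

theorem bkA_add_right (q : ℂ) (x y y' : Aq) :
    bkA q x (y + y') = bkA q x y + bkA q x y' := by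
  unfold bkA
  rw [← Finsupp.sum_add]
  refine Finsupp.sum_congr fun i _ => ?_
  rw [Finsupp.sum_add_index']
  · intro i; simp
  · intro j a b; rw [mul_add, add_smul]

theorem alq_add (q : ℂ) (x y : Aq) : alq q (x + y) = alq q x + alq q y := by
  unfold alq
  rw [Finsupp.sum_add_index']
  · intro i; simp
  · intro j a b; rw [mul_add, Finsupp.single_add]

theorem cA_zero_left (c : BIdx → BIdx → ℂ) (y : Aq) : cA c 0 y = 0 := by simp [cA]
theorem cA_zero_right (c : BIdx → BIdx → ℂ) (y : Aq) : cA c y 0 = 0 := by simp [cA]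
theorem bkA_zero_left (q : ℂ) (y : Aq) : bkA q 0 y = 0 := by simp [bkA]
theorem bkA_zero_right (q : ℂ) (y : Aq) : bkA q y 0 = 0 := by simp [bkA]
theorem alq_zero (q : ℂ) : alq q 0 = 0 := by simp [alq]

theorem alq_single (q : ℂ) (i : BIdx) (a : ℂ) :
    alq q (single i a) = single i (acoef q i * a) := by
  simp [alq]

theorem bkA_single (q : ℂ) (i j : BIdx) (a b : ℂ) :
    bkA q (single i a) (single j b) = (a * b) • bk q i j := by
  simp [bkA]

theorem cA_single (c : BIdx → BIdx → ℂ) (i j : BIdx) (a b : ℂ) :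
    cA c (single i a) (single j b) = a * b * c i j := by
  simp [cA]

theorem phi1_odd_right (q : ℂ) (i j : BIdx) (h : j.parity = true) : phi1 q i j = 0 := by
  cases i <;> cases j <;> simp_all [phi1, BIdx.parity]

/-- Pairing with the twist of an odd element vanishes. -/
theorem cA_alq_odd (q : ℂ) (z x : Aq) (h : homOf true x) :
    cA (phi1 q) z (alq q x) = 0 := by
  have key : ∀ y : Aq, cA (phi1 q) z (alq q y) =
      y.sum fun j b => cA (phi1 q) z (single j (acoef q j * b)) := by
    intro y
    induction y using Finsupp.induction_linear with
    | zero => simp [alq_zero, cA_zero_right]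
    | add f g hf hg =>
      rw [alq_add, cA_add_right, hf, hg, Finsupp.sum_add_index']
      · intro i; simp [cA_zero_right]
      · intro i a b; rw [mul_add, Finsupp.single_add, cA_add_right]
    | single i a => rw [alq_single]; simp [cA_zero_right]
  rw [key]
  refine Finset.sum_eq_zero fun j hj => ?_
  have := h j hj
  show cA (phi1 q) z (single j (acoef q j * x j)) = 0
  generalize acoef q j * x j = t
  simp [cA, phi1_odd_right q _ j this]

/-- The central computation on the Virasoro part. -/
theorem phi1_LLL (q : ℂ) (hq0 : q ≠ 0) (hq1 : q ≠ 1)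
    (hq : ∀ n : ℤ, q ^ n ≠ -1) (a b c : ℤ) :
    -((qnum q a - qnum q b) * (1 + q ^ c) * phi1 q (.L (a + b)) (.L c))
      + (qnum q a - qnum q c) * (1 + q ^ b) * phi1 q (.L (a + c)) (.L b)
      + (1 + q ^ a) * (qnum q b - qnum q c) * phi1 q (.L a) (.L (b + c)) = 0 := by
  by_cases h : a + b + c = 0
  · have h1 : a + c + b = 0 := by omega
    have h2 : a + (b + c) = 0 := by omega
    obtain rfl : c = -(a + b) := by omega
    have e : a + -(a + b) = -b := by ring
    simp only [phi1, if_pos h, if_pos h1, if_pos h2, qnum]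
    rw [e]
    have hx : q ^ a ≠ 0 := zpow_ne_zero _ hq0
    have hy : q ^ b ≠ 0 := zpow_ne_zero _ hq0
    have h1q : 1 - q ≠ 0 := sub_ne_zero.mpr (Ne.symm hq1)
    have d1 : 1 + q ^ a ≠ 0 := fun h => hq a (by linear_combination h)
    have d2 : 1 + q ^ b ≠ 0 := fun h => hq b (by linear_combination h)
    have d3 : 1 + q ^ a * q ^ b ≠ 0 := fun h => hq (a + b) (by
      rw [zpow_add₀ hq0]; linear_combination h)
    have d4 : q ^ b + 1 ≠ 0 := by rwa [add_comm]
    have d5 : q ^ a * q ^ b + 1 ≠ 0 := by rwa [add_comm]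
    simp only [zpow_add₀ hq0, zpow_sub₀ hq0, zpow_neg, zpow_one, neg_neg]
    generalize q ^ a = x at *
    generalize q ^ b = y at *
    have e2 : 1 + y⁻¹ = (y + 1) / y := by field_simp
    have e3 : 1 + (x * y)⁻¹ = (x * y + 1) / (x * y) := by field_simp
    rw [e2, e3]
    field_simp
    ring
  · have h1 : ¬ a + c + b = 0 := by omega
    have h2 : ¬ a + (b + c) = 0 := by omega
    simp [phi1, h, h1, h2]

theorem phi1_basis (q : ℂ) (hq0 : q ≠ 0) (hq1 : q ≠ 1)
    (hq : ∀ n : ℤ, q ^ n ≠ -1) (i j k : BIdx) (a b c : ℂ) :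
    -(cA (phi1 q) (bkA q (single i a) (single j b)) (alq q (single k c)))
      + cA (phi1 q) (bkA q (single i a) (single k c)) (alq q (single j b))
      + cA (phi1 q) (alq q (single i a)) (bkA q (single j b) (single k c)) = 0 := by
  simp only [alq_single, bkA_single]
  rcases i with i | i | i | i <;> rcases j with j | j | j | j <;>
    rcases k with k | k | k | k <;>
    simp only [bk, Finsupp.smul_single, smul_zero, cA_single, cA_zero_left, cA_zero_right,
      smul_eq_mul, acoef]
  case L.L.L => linear_combination (a * b * c) * phi1_LLL q hq0 hq1 hq i j k
  all_goals simp [phi1]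

theorem phi1_all (q : ℂ) (hq0 : q ≠ 0) (hq1 : q ≠ 1)
    (hq : ∀ n : ℤ, q ^ n ≠ -1) (x y z : Aq) :
    -(cA (phi1 q) (bkA q x y) (alq q z)) + cA (phi1 q) (bkA q x z) (alq q y)
      + cA (phi1 q) (alq q x) (bkA q y z) = 0 := by
  induction x using Finsupp.induction_linear with
  | zero => simp [alq_zero, bkA_zero_left, cA_zero_left]
  | add f g hf hg =>
    simp only [alq_add, bkA_add_left, cA_add_left]
    linear_combination hf + hg
  | single i a =>
    induction y using Finsupp.induction_linear with
    | zero => simp [alq_zero, bkA_zero_left, bkA_zero_right, cA_zero_left, cA_zero_right]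
    | add f g hf hg =>
      simp only [alq_add, bkA_add_left, bkA_add_right, cA_add_left, cA_add_right]
      linear_combination hf + hg
    | single j b =>
      induction z using Finsupp.induction_linear with
      | zero => simp [alq_zero, bkA_zero_right, cA_zero_left, cA_zero_right]
      | add f g hf hg =>
        simp only [alq_add, bkA_add_right, cA_add_left, cA_add_right]
        linear_combination hf + hg
      | single k c => exact phi1_basis q hq0 hq1 hq i j k a b c

/-- assuming `qⁿ ≠ −1` for all `n ∈ ℤ`, the bilinear map `ϕ = phi1`
satisfies the 2-cocycle identity for all homogeneous `x₀, x₁, x₂ ∈ 𝔄_q`. -/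
theorem phi1_is_two_cocycle (q : ℂ) (hq0 : q ≠ 0) (hq1 : q ≠ 1)
    (hq : ∀ n : ℤ, q ^ n ≠ -1) :
    Cocycle2Identity q (phi1 q) := by
  intro p0 p1 p2 x0 x1 x2 _ h1 _
  have h := phi1_all q hq0 hq1 hq x0 x1 x2
  have hs : sgn p1 p2 * cA (phi1 q) (bkA q x0 x2) (alq q x1)
      = cA (phi1 q) (bkA q x0 x2) (alq q x1) := by
    cases p1
    · simp [sgn]
    · rw [cA_alq_odd q _ x1 h1, mul_zero]
  rw [hs]
  exact h
end

section
/- For every s ∈ ℤ with q^s ≠ −1, the inner maps ad_{L_s}: x ↦ [L_s, x]_q and ad_{I_s}: x ↦ [I_s, x]_q are even q-derivations of 𝔄_q homogeneous of degree s; that is, they map span{L_n, I_n} into span{L_{n+s}, I_{n+s}} and span{G_n, T_n} into span{G_{n+s}, T_{n+s}}, and satisfy φ([x,y]_q) = (1+q^s)^{−1}([φ(x), α_q(y)]_q + [α_q(x), φ(y)]_q) for all homogeneous x, y. -/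
open Finsupp

/-- The span of the basis elements `L_n, I_n`. -/
noncomputable def spanLI (n : ℤ) : Submodule ℂ Aq :=
  Submodule.span ℂ {single (BIdx.L n) (1 : ℂ), single (BIdx.I n) (1 : ℂ)}

/-- The span of the basis elements `G_n, T_n`. -/
noncomputable def spanGT (n : ℤ) : Submodule ℂ Aq :=
  Submodule.span ℂ {single (BIdx.G n) (1 : ℂ), single (BIdx.T n) (1 : ℂ)}

/-- The linear extension of a map `D` given by its values on the basis. -/
noncomputable def DA (D : BIdx → Aq) (x : Aq) : Aq := x.sum fun i a => a • D i

/-- The sign `(−1)^{|x|}` for a parity `b`. -/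
noncomputable def sgn1 (b : Bool) : ℂ := if b then -1 else 1

/-- `φ` (given by its values on the basis, extended linearly) is an even `q`-derivation of
`𝔄_q` homogeneous of degree `s`: it maps `span{L_n, I_n}` into `span{L_{n+s}, I_{n+s}}`
and `span{G_n, T_n}` into `span{G_{n+s}, T_{n+s}}`, and satisfies
`φ([x,y]_q) = (1+q^s)⁻¹ ([φ x, α_q y]_q + [α_q x, φ y]_q)` for homogeneous `x, y`. -/
def IsEvenQDerivationSpan (q : ℂ) (s : ℤ) (φ : BIdx → Aq) : Prop :=
  (∀ n : ℤ, ∀ x ∈ spanLI n, DA φ x ∈ spanLI (n + s)) ∧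
  (∀ n : ℤ, ∀ x ∈ spanGT n, DA φ x ∈ spanGT (n + s)) ∧
  ∀ (px py : Bool) (x y : Aq), homOf px x → homOf py y →
    DA φ (bkA q x y) =
      (1 + q ^ s)⁻¹ • (bkA q (DA φ x) (alq q y) + bkA q (alq q x) (DA φ y))

/-- `DA` as a linear map. -/
noncomputable def DAl (D : BIdx → Aq) : Aq →ₗ[ℂ] Aq := Finsupp.linearCombination ℂ D

theorem DA_eq (D : BIdx → Aq) (x : Aq) : DA D x = DAl D x := rfl

/-- `bkA` as a bilinear map. -/
noncomputable def bkl (q : ℂ) : Aq →ₗ[ℂ] Aq →ₗ[ℂ] Aq :=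
  Finsupp.linearCombination ℂ (fun i => Finsupp.linearCombination ℂ (bk q i))

theorem bkA_eq (q : ℂ) (x y : Aq) : bkA q x y = bkl q x y := by
  simp only [bkA, bkl, Finsupp.linearCombination_apply, Finsupp.sum, LinearMap.sum_apply,
    LinearMap.smul_apply, Finset.smul_sum, mul_smul]

/-- `alq` as a linear map. -/
noncomputable def all (q : ℂ) : Aq →ₗ[ℂ] Aq :=
  Finsupp.linearCombination ℂ (fun i => single i (acoef q i))

theorem alq_eq (q : ℂ) (x : Aq) : alq q x = all q x := by
  simp [alq, all, Finsupp.linearCombination_apply, Finsupp.smul_single, mul_comm]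

theorem DAl_single (D : BIdx → Aq) (i : BIdx) (a : ℂ) : DAl D (single i a) = a • D i := by
  simp [DAl]

theorem bkl_single (q : ℂ) (i j : BIdx) (a b : ℂ) :
    bkl q (single i a) (single j b) = (a * b) • bk q i j := by
  simp [bkl, mul_smul]

theorem all_single (q : ℂ) (i : BIdx) (a : ℂ) :
    all q (single i a) = single i (a * acoef q i) := by
  simp [all]

/-- The derivation identity follows from its instances on the basis. -/
theorem der_of_basis (q c : ℂ) (φ : BIdx → Aq)
    (h : ∀ i j, DAl φ (bk q i j) =
      c • (bkl q (φ i) (single j (acoef q j)) + bkl q (single i (acoef q i)) (φ j)))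
    (x y : Aq) :
    DA φ (bkA q x y) = c • (bkA q (DA φ x) (alq q y) + bkA q (alq q x) (DA φ y)) := by
  simp only [DA_eq, bkA_eq, alq_eq]
  have key : (bkl q).compr₂ (DAl φ) =
      c • ((bkl q).compl₁₂ (DAl φ) (all q) + (bkl q).compl₁₂ (all q) (DAl φ)) := by
    ext i j : 4
    simpa [DAl_single, bkl_single, all_single] using h i j
  simpa using LinearMap.congr_fun₂ key x y

theorem span_pair_map (φ : BIdx → Aq) (i j : BIdx) (S : Submodule ℂ Aq)
    (hi : φ i ∈ S) (hj : φ j ∈ S) :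
    ∀ x ∈ Submodule.span ℂ {single i (1 : ℂ), single j (1 : ℂ)}, DA φ x ∈ S := by
  intro x hx
  rw [Submodule.mem_span_pair] at hx
  obtain ⟨a, b, rfl⟩ := hx
  rw [DA_eq, map_add, map_smul, map_smul, DAl_single, DAl_single, one_smul, one_smul]
  exact S.add_mem (S.smul_mem _ hi) (S.smul_mem _ hj)

theorem single_mem_span_left (i j : BIdx) (a : ℂ) :
    single i a ∈ Submodule.span ℂ {single i (1 : ℂ), single j (1 : ℂ)} :=
  Submodule.mem_span_pair.2 ⟨a, 0, by simp⟩

theorem single_mem_span_right (i j : BIdx) (a : ℂ) :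
    single j a ∈ Submodule.span ℂ {single i (1 : ℂ), single j (1 : ℂ)} :=
  Submodule.mem_span_pair.2 ⟨0, a, by simp⟩

/-- for every `s ∈ ℤ` with `q^s ≠ −1`, the inner maps
`ad_{L_s} : x ↦ [L_s, x]_q` and `ad_{I_s} : x ↦ [I_s, x]_q` are even `q`-derivations of
`𝔄_q` homogeneous of degree `s`. -/
theorem ad_L_and_ad_I_are_even_q_derivations
    (q : ℂ) (hq0 : q ≠ 0) (hq1 : q ≠ 1) (s : ℤ) (hqs : q ^ s ≠ -1) :
    IsEvenQDerivationSpan q s (fun i => bk q (.L s) i) ∧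
    IsEvenQDerivationSpan q s (fun i => bk q (.I s) i) := by
  have h1 : (1 : ℂ) - q ≠ 0 := sub_ne_zero.2 (Ne.symm hq1)
  have h2 : (1 : ℂ) + q ^ s ≠ 0 := fun h => hqs (by linear_combination h)
  refine ⟨⟨fun n => ?_, fun n => ?_, fun _ _ x y _ _ => der_of_basis q _ _ ?_ x y⟩,
    ⟨fun n => ?_, fun n => ?_, fun _ _ x y _ _ => der_of_basis q _ _ ?_ x y⟩⟩
  · apply span_pair_map
    · rw [add_comm n s]; exact single_mem_span_left _ _ _
    · rw [add_comm n s]; exact single_mem_span_right _ _ _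
  · apply span_pair_map
    · rw [add_comm n s]; exact single_mem_span_left _ _ _
    · rw [add_comm n s]; exact single_mem_span_right _ _ _
  · rintro (m | m | m | m) (n | n | n | n) <;>
      simp only [bk, DAl_single, bkl_single, smul_single, map_zero, LinearMap.zero_apply, smul_zero,
        add_zero, zero_add, smul_eq_mul, acoef, add_left_comm m s n, add_assoc, ← single_add] <;>
      congr 1 <;> simp only [qnum, zpow_add₀ hq0, zpow_one] <;> field_simp <;> ring
  · apply span_pair_map
    · rw [add_comm n s]; exact single_mem_span_right _ _ _
    · exact Submodule.zero_mem _
  · apply span_pair_map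
    · rw [add_comm n s]; exact single_mem_span_right _ _ _
    · exact Submodule.zero_mem _
  · rintro (m | m | m | m) (n | n | n | n) <;>
      simp only [bk, DAl_single, bkl_single, smul_single, map_zero, LinearMap.zero_apply, smul_zero,
        add_zero, zero_add, smul_eq_mul, acoef, add_left_comm m s n, add_assoc, ← single_add] <;>
      congr 1 <;> simp only [qnum, zpow_add₀ hq0, zpow_one] <;> field_simp <;> ring
end
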